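/- The product of two symmetrized Pauli operators is a linear combination of symmetrized Pauli operators: A_𝐢 · A_𝐣 = Σ_𝐤 X^{𝐢,𝐣}_𝐤 A_𝐤, where X^{𝐢,𝐣}_𝐤 = Σ_{f} [k₁!/(f₁₁! f_xx! f_yy! f_zz!)] · [k_x!/(f₁ₓ! f_x1! f_yz! f_zy!)] · [k_y!/(f₁_y! f_y1! f_xz! f_zx!)] · [k_z!/(f₁_z! f_z1! f_xy! f_yx!)] · i^{f_xy+f_yz+f_zx} · (-i)^{f_yx+f_xz+f_zy}, the sum running over nonnegative integer matrices (f_{ab})_{a,b∈{1,x,y,z}} with column sums Σ_a f_{ab} = j_b, row sums Σ_b f_{ab} = i_a, and f₁₁+f_xx+f_yy+f_zz = k₁, f₁ₓ+f_x1+f_yz+f_zy = k_x, f₁_y+f_y1+f_xz+f_zx = k_y, f₁_z+f_z1+f_xy+f_yx = k_z. -/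

import Mathlib

open Matrix

noncomputable section

/-- The Pauli matrices `σ₁ = I, σx, σy, σz`, indexed by `0,1,2,3`. -/
def pauli : Fin 4 → Matrix (Fin 2) (Fin 2) ℂ :=
  ![1, !![0, 1; 1, 0], !![0, -Complex.I; Complex.I, 0], !![1, 0; 0, -1]]

/-- The label of the product of two Pauli matrices: `σ_a σ_b ∝ σ_{pmul a b}`. -/
def pmul : Fin 4 → Fin 4 → Fin 4 :=
  ![![0, 1, 2, 3], ![1, 0, 3, 2], ![2, 3, 0, 1], ![3, 2, 1, 0]]

/-- The Pauli word `σ_{p 1} ⊗ ⋯ ⊗ σ_{p n}` as a matrix on `(ℂ²)^⊗n`. -/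
def pauliWord (n : ℕ) (p : Fin n → Fin 4) :
    Matrix (Fin n → Fin 2) (Fin n → Fin 2) ℂ :=
  Matrix.of fun s t => ∏ i, pauli (p i) (s i) (t i)

/-- The symmetrized Pauli operator `A_𝐢 = ∑_{p ∈ P_𝐢} p`. -/
def Asym (n : ℕ) (iv : Fin 4 → ℕ) :
    Matrix (Fin n → Fin 2) (Fin n → Fin 2) ℂ :=
  ∑ p ∈ Finset.univ.filter
      (fun p : Fin n → Fin 4 =>
        ∀ a, (Finset.univ.filter fun i => p i = a).card = iv a),
    pauliWord n p

/-- The structure constants `X^{𝐢,𝐣}_𝐤`: a sum over nonnegative-integer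
matrices `f = (f_{ab})_{a,b ∈ {1,x,y,z}}` with row sums `𝐢`, column sums `𝐣`,
and with `∑_{(a,b) : σ_a σ_b ∝ σ_c} f_{ab} = k_c`, of the multinomial
coefficients `∏_c k_c!/∏_{(a,b) : σ_a σ_b ∝ σ_c} f_{ab}!` times the phase
`i^{f_xy + f_yz + f_zx} (-i)^{f_yx + f_xz + f_zy}`. -/
def Xconst (n : ℕ) (iv jv kv : Fin 4 → ℕ) : ℂ :=
  ∑ f ∈ (Finset.univ : Finset (Fin 4 → Fin 4 → Fin (n + 1))).filter
      (fun f =>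
        (∀ a, ∑ b, ((f a b : ℕ)) = iv a) ∧
        (∀ b, ∑ a, ((f a b : ℕ)) = jv b) ∧
        (∀ c, ∑ q ∈ (Finset.univ.filter
            fun q : Fin 4 × Fin 4 => pmul q.1 q.2 = c), ((f q.1 q.2 : ℕ)) = kv c)),
    (∏ c, (Nat.factorial (kv c) : ℂ)) /
        (∏ a, ∏ b, (Nat.factorial (f a b : ℕ) : ℂ)) *
      Complex.I ^ ((f 1 2 : ℕ) + (f 2 3 : ℕ) + (f 3 1 : ℕ)) *
      (-Complex.I) ^ ((f 2 1 : ℕ) + (f 1 3 : ℕ) + (f 3 2 : ℕ))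

section Counting

variable {ι B C : Type*} [Fintype ι] [DecidableEq B]

/-- The number of occurrences of the letter `b` in the word `w`. -/
def letterCount (w : ι → B) (b : B) : ℕ :=
  (Finset.univ.filter fun i => w i = b).card

lemma exists_perm_of_letterCount_eq (u v : ι → B) (h : letterCount u = letterCount v) :
    ∃ σ : Equiv.Perm ι, v ∘ σ = u := by
  have e : ∀ b, Nonempty ({i // u i = b} ≃ {i // v i = b}) := fun b => by
    classical
    refine ⟨Fintype.equivOfCardEq ?_⟩
    rw [Fintype.card_subtype, Fintype.card_subtype]
    exact congrFun h b
  replace e := fun b => (e b).some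
  exact ⟨Equiv.ofFiberEquiv e, funext fun i => Equiv.ofFiberEquiv_map e i⟩

lemma letterCount_comp_perm (w : ι → B) (σ : Equiv.Perm ι) :
    letterCount (w ∘ σ) = letterCount w := by
  funext b
  exact Finset.card_equiv σ (by simp)

lemma exists_letterCount_eq [Fintype B] (f : B → ℕ) (hf : ∑ b, f b = Fintype.card ι) :
    ∃ w : ι → B, letterCount w = f := by
  have e : ι ≃ Σ b, Fin (f b) := Fintype.equivOfCardEq (by simp [hf])
  refine ⟨fun i => (e i).1, funext fun b => ?_⟩
  have h : (Finset.univ.filter fun i => (e i).1 = b).card =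
      (Finset.univ.filter fun x : Σ b, Fin (f b) => x.1 = b).card :=
    Finset.card_equiv e (by simp)
  rw [letterCount, h, Finset.card_filter, Fintype.sum_sigma,
    Finset.sum_eq_single b (fun c _ hc => Finset.sum_eq_zero fun _ _ => if_neg hc) (by simp)]
  simp

lemma letterCount_comp [Fintype B] [DecidableEq C] (g : B → C) (w : ι → B) (c : C) :
    letterCount (g ∘ w) c = ∑ b ∈ Finset.univ.filter (fun b => g b = c), letterCount w b := by
  rw [letterCount, Finset.card_eq_sum_card_fiberwise (f := w)
    (t := Finset.univ.filter fun b => g b = c) (by intro i; simp)]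
  refine Finset.sum_congr rfl fun b hb => ?_
  rw [letterCount, Finset.filter_filter]
  congr 1
  ext i
  have := (Finset.mem_filter.1 hb).2
  simp only [Finset.mem_filter, Finset.mem_univ, true_and, Function.comp_apply]
  grind

lemma sum_letterCount [Fintype B] (w : ι → B) : ∑ b, letterCount w b = Fintype.card ι := by
  rw [← Finset.card_univ,
    Finset.card_eq_sum_card_fiberwise (f := w) (t := Finset.univ) (by intro i; simp)]
  rfl

lemma card_perm_comp_eq_self [DecidableEq ι] [Fintype B] (w : ι → B) :
    (Finset.univ.filter fun σ : Equiv.Perm ι => w ∘ σ = w).card =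
      ∏ b, (letterCount w b).factorial := by
  rw [← Fintype.card_subtype, DomMulAct.stabilizer_card]
  exact Finset.prod_congr rfl fun b _ => by rw [Fintype.card_subtype]; rfl

/-- The number of words with letter counts `f` lying above a given word `r` is a product of
multinomial coefficients. -/
lemma card_lifts_mul_prod_factorial [DecidableEq ι] [Fintype B] [Fintype C] [DecidableEq C]
    (g : B → C) (r : ι → C) (f : B → ℕ)
    (hf : ∀ c, ∑ b ∈ Finset.univ.filter (fun b => g b = c), f b = letterCount r c) :
    (Finset.univ.filter fun w : ι → B => g ∘ w = r ∧ letterCount w = f).card *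
      ∏ b, (f b).factorial = ∏ c, (letterCount r c).factorial := by
  have htot : ∑ b, f b = Fintype.card ι := by
    rw [← sum_letterCount r, ← Finset.sum_fiberwise Finset.univ g f]
    exact Finset.sum_congr rfl fun c _ => hf c
  obtain ⟨v, hv⟩ := exists_letterCount_eq (ι := ι) f htot
  obtain ⟨τ, hτ⟩ := exists_perm_of_letterCount_eq r (g ∘ v)
    (funext fun c => by rw [letterCount_comp, hv, hf])
  obtain ⟨w₀, hw₀, hr⟩ : ∃ w₀ : ι → B, letterCount w₀ = f ∧ g ∘ w₀ = r :=
    ⟨v ∘ τ, by rw [letterCount_comp_perm, hv], hτ⟩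
  rw [← card_perm_comp_eq_self r, ← hw₀, ← card_perm_comp_eq_self w₀]
  rw [Finset.card_eq_sum_card_fiberwise (s := Finset.univ.filter fun σ : Equiv.Perm ι => r ∘ σ = r)
    (f := fun σ : Equiv.Perm ι => w₀ ∘ σ)
    (t := Finset.univ.filter fun w : ι → B => g ∘ w = r ∧ letterCount w = letterCount w₀)]
  · refine (Finset.sum_const_nat fun w hw => ?_).symm
    obtain ⟨hwr, hwc⟩ := (Finset.mem_filter.1 hw).2
    obtain ⟨τ, rfl⟩ := exists_perm_of_letterCount_eq w w₀ hwc
    refine Finset.card_equiv (Equiv.mulRight τ⁻¹) fun σ => ?_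
    have hiff : w₀ ∘ (σ * τ⁻¹ : Equiv.Perm ι) = w₀ ↔ w₀ ∘ σ = w₀ ∘ τ := by
      rw [Equiv.Perm.coe_mul, ← Function.comp_assoc]
      exact Equiv.comp_symm_eq τ w₀ (w₀ ∘ σ)
    simp only [Finset.mem_filter, Finset.mem_univ, true_and, Equiv.coe_mulRight, hiff,
      and_iff_right_iff_imp]
    intro h
    rw [← hr, Function.comp_assoc, h, hwr, hr]
  · intro σ hσ
    simp only [Finset.coe_filter, Finset.mem_univ, true_and, Set.mem_ofPred_eq] at hσ ⊢
    exact ⟨by rw [← Function.comp_assoc, hr, hσ], letterCount_comp_perm w₀ σ⟩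

end Counting

/-- The scalar `c` in `σ_a σ_b = c σ_{pmul a b}`. -/
def pauliPhase : Fin 4 × Fin 4 → ℂ := fun q =>
  (![![1, 1, 1, 1], ![1, 1, Complex.I, -Complex.I], ![1, -Complex.I, 1, Complex.I],
    ![1, Complex.I, -Complex.I, 1]] : Fin 4 → Fin 4 → ℂ) q.1 q.2

lemma pauli_mul_pauli (a b : Fin 4) :
    pauli a * pauli b = pauliPhase (a, b) • pauli (pmul a b) := by
  fin_cases a <;> fin_cases b <;> ext i j <;> fin_cases i <;> fin_cases j <;>
    simp [pauli, pauliPhase, pmul, Matrix.mul_apply, Fin.sum_univ_two]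

lemma pauliWord_mul_pauliWord (n : ℕ) (p q : Fin n → Fin 4) :
    pauliWord n p * pauliWord n q =
      (∏ i, pauliPhase (p i, q i)) • pauliWord n fun i => pmul (p i) (q i) := by
  ext s t
  simp only [pauliWord, Matrix.mul_apply, Matrix.of_apply, Matrix.smul_apply, smul_eq_mul,
    ← Finset.prod_mul_distrib]
  rw [← Fintype.prod_sum fun i x => pauli (p i) (s i) x * pauli (q i) x (t i)]
  refine Finset.prod_congr rfl fun i _ => ?_
  rw [← Matrix.mul_apply, pauli_mul_pauli, Matrix.smul_apply, smul_eq_mul]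

lemma prod_pauliPhase {n : ℕ} (w : Fin n → Fin 4 × Fin 4) :
    ∏ i, pauliPhase (w i) =
      Complex.I ^ (letterCount w (1, 2) + letterCount w (2, 3) + letterCount w (3, 1)) *
        (-Complex.I) ^ (letterCount w (2, 1) + letterCount w (1, 3) + letterCount w (3, 2)) := by
  have h : ∏ i, pauliPhase (w i) = ∏ q, pauliPhase q ^ letterCount w q := by
    rw [← Finset.prod_fiberwise Finset.univ w]
    refine Finset.prod_congr rfl fun q _ => ?_
    rw [letterCount, ← Finset.prod_const]
    exact Finset.prod_congr rfl fun i hi => by rw [(Finset.mem_filter.1 hi).2]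
  rw [h, Fintype.prod_prod_type]
  simp [Fin.prod_univ_four, pauliPhase]
  ring

lemma Asym_eq_sum_letterCount (n : ℕ) (iv : Fin 4 → ℕ) :
    Asym n iv = ∑ p ∈ Finset.univ.filter (fun p : Fin n → Fin 4 => letterCount p = iv),
      pauliWord n p := by
  simp only [Asym, funext_iff, letterCount]

lemma Asym_mul_Asym (n : ℕ) (iv jv : Fin 4 → ℕ) :
    Asym n iv * Asym n jv = ∑ w ∈ Finset.univ.filter (fun w : Fin n → Fin 4 × Fin 4 =>
        letterCount (Prod.fst ∘ w) = iv ∧ letterCount (Prod.snd ∘ w) = jv),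
      (∏ i, pauliPhase (w i)) • pauliWord n (fun i => pmul (w i).1 (w i).2) := by
  rw [Asym_eq_sum_letterCount, Asym_eq_sum_letterCount, Finset.sum_mul_sum,
    ← Finset.sum_product']
  refine Finset.sum_equiv
    (Equiv.arrowProdEquivProdArrow (Fin n) (fun _ => Fin 4) (fun _ => Fin 4)).symm ?_ ?_
  · simp [Equiv.arrowProdEquivProdArrow, Function.comp_def]
  · intro x _
    exact pauliWord_mul_pauliWord n x.1 x.2

lemma letterCount_fst {n : ℕ} (w : Fin n → Fin 4 × Fin 4) (a : Fin 4) :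
    letterCount (Prod.fst ∘ w) a = ∑ b, letterCount w (a, b) := by
  rw [letterCount_comp]
  simp [Finset.sum_filter, Fintype.sum_prod_type, Fin.sum_univ_four]
  fin_cases a <;> simp

lemma letterCount_snd {n : ℕ} (w : Fin n → Fin 4 × Fin 4) (b : Fin 4) :
    letterCount (Prod.snd ∘ w) b = ∑ a, letterCount w (a, b) := by
  rw [letterCount_comp]
  simp [Finset.sum_filter, Fintype.sum_prod_type]

lemma letterCount_lt_succ {n : ℕ} {B : Type*} [DecidableEq B] (w : Fin n → B) (b : B) :
    letterCount w b < n + 1 :=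
  Nat.lt_succ_of_le ((Finset.card_le_univ _).trans_eq (Fintype.card_fin n))

lemma sum_prod_pauliPhase_eq_Xconst (n : ℕ) (iv jv : Fin 4 → ℕ) (r : Fin n → Fin 4) :
    ∑ w ∈ Finset.univ.filter (fun w : Fin n → Fin 4 × Fin 4 =>
        (letterCount (Prod.fst ∘ w) = iv ∧ letterCount (Prod.snd ∘ w) = jv) ∧
          (fun i => pmul (w i).1 (w i).2) = r),
      ∏ i, pauliPhase (w i) = Xconst n iv jv (letterCount r) := by
  rw [Xconst]
  rw [← Finset.sum_fiberwise_of_maps_to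
    (g := fun (w : Fin n → Fin 4 × Fin 4) a b =>
      (⟨letterCount w (a, b), letterCount_lt_succ w (a, b)⟩ : Fin (n + 1)))]
  · refine Finset.sum_congr rfl fun f hf => ?_
    obtain ⟨hrow, hcol, hk⟩ := (Finset.mem_filter.1 hf).2
    have hcard := card_lifts_mul_prod_factorial (fun q : Fin 4 × Fin 4 => pmul q.1 q.2) r
      (fun q => (f q.1 q.2 : ℕ)) hk
    have hset : (Finset.univ.filter (fun w : Fin n → Fin 4 × Fin 4 =>
        (letterCount (Prod.fst ∘ w) = iv ∧ letterCount (Prod.snd ∘ w) = jv) ∧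
          (fun i => pmul (w i).1 (w i).2) = r)).filter (fun w =>
            (fun a b => (⟨letterCount w (a, b), letterCount_lt_succ w (a, b)⟩ : Fin (n + 1))) = f) =
        Finset.univ.filter fun w : Fin n → Fin 4 × Fin 4 =>
          (fun q : Fin 4 × Fin 4 => pmul q.1 q.2) ∘ w = r ∧
            letterCount w = fun q => (f q.1 q.2 : ℕ) := by
      ext w
      simp only [Finset.mem_filter, Finset.mem_univ, true_and]
      constructor
      · rintro ⟨⟨-, hr⟩, rfl⟩
        exact ⟨hr, rfl⟩
      · rintro ⟨hr, hw⟩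
        refine ⟨⟨⟨funext fun a => ?_, funext fun b => ?_⟩, hr⟩, ?_⟩
        · rw [letterCount_fst, hw, hrow]
        · rw [letterCount_snd, hw, hcol]
        · funext a b
          exact Fin.ext (congrFun hw (a, b))
    rw [hset, Finset.sum_congr rfl fun w hw => by
      rw [prod_pauliPhase, (Finset.mem_filter.1 hw).2.2], Finset.sum_const, nsmul_eq_mul,
      ← mul_assoc]
    rw [Fintype.prod_prod_type] at hcard
    refine congrArg₂ _ (congrArg₂ _ ((eq_div_iff ?_).2 ?_) rfl) rfl
    · simp [Finset.prod_eq_zero_iff, Nat.factorial_ne_zero]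
    · exact_mod_cast hcard
  · intro w hw
    obtain ⟨⟨hi, hj⟩, hr⟩ := (Finset.mem_filter.1 hw).2
    refine Finset.mem_filter.2 ⟨Finset.mem_univ _, fun a => ?_, fun b => ?_, fun c => ?_⟩
    · rw [← hi, letterCount_fst]
    · rw [← hj, letterCount_snd]
    · rw [← hr]
      exact (letterCount_comp (fun q : Fin 4 × Fin 4 => pmul q.1 q.2) w c).symm

/-- The product of two symmetrized Pauli operators is a linear combination of
symmetrized Pauli operators with the explicit structure constants `X^{𝐢,𝐣}_𝐤`. -/
theorem symmetrized_pauli_structure_constants (n : ℕ) (iv jv : Fin 4 → ℕ)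
    (hi : ∑ a, iv a = n) (hj : ∑ a, jv a = n) :
    Asym n iv * Asym n jv =
      ∑ kv ∈ Finset.Nat.antidiagonalTuple 4 n, Xconst n iv jv kv • Asym n kv := by
  rw [Asym_mul_Asym,
    ← Finset.sum_fiberwise _ fun (w : Fin n → Fin 4 × Fin 4) i => pmul (w i).1 (w i).2]
  simp_rw [Asym_eq_sum_letterCount, Finset.smul_sum]
  rw [← Finset.sum_fiberwise_of_maps_to (s := Finset.univ)
    (t := Finset.Nat.antidiagonalTuple 4 n) (g := fun r : Fin n → Fin 4 => letterCount r)
    fun r _ => by rw [Finset.Nat.mem_antidiagonalTuple, sum_letterCount, Fintype.card_fin]]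
  refine Finset.sum_congr rfl fun kv _ => Finset.sum_congr rfl fun r hr => ?_
  rw [← (Finset.mem_filter.1 hr).2, ← sum_prod_pauliPhase_eq_Xconst, Finset.sum_smul,
    Finset.filter_filter]
  exact Finset.sum_congr rfl fun w hw => by rw [(Finset.mem_filter.1 hw).2.2]
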